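/- Let G be a countable monoid, R a ring, and A an Artinian R-module. Let Σ ⊆ A^G be a subshift that is closed in the prodiscrete topology and is an R-submodule of A^G. Let τ_1, …, τ_r : Σ → Σ be pairwise commuting maps, each of which is the restriction to Σ of a cellular automaton A^G → A^G that maps Σ into Σ and admits a memory set with R-linear local defining map. Let Γ be the monoid of maps Σ → Σ generated by τ_1, …, τ_r under composition. Then the valuation action T(τ, x) := τ(x) of Γ on Σ has the shadowing property. -/

import Mathlib

/-- The right shift action: `(g ⋆ x)(h) = x (h * g)`. -/
def shiftMul {G A : Type*} [Mul G] (g : G) (x : G → A) : G → A := fun h => x (h * g)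

/-- An exhaustion of a countable monoid: `E 0 = ∅`, increasing, covering `G`,
with each `E n` finite. -/
def IsExhaustion {G : Type*} (E : ℕ → Finset G) : Prop :=
  E 0 = ∅ ∧ (∀ n, E n ⊆ E (n + 1)) ∧ ∀ g : G, ∃ n, g ∈ E n

open Classical in
/-- The standard Hamming metric associated with the exhaustion `E`:
`d(x,y) = 2^{-n}` with `n = sup {k | x = y on E k}`, and `0` if `x = y`. -/
noncomputable def hamming {G A : Type*} (E : ℕ → Finset G) (x y : G → A) : ℝ :=
  if x = y then 0 else (2 : ℝ)⁻¹ ^ sSup {k : ℕ | ∀ g ∈ E k, x g = y g}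

/-- `(S, d, δ)`-pseudo-orbit of the action `T` of `Γ` on `X`. -/
def IsPseudoOrbit {Γ X : Type*} [Monoid Γ] (T : Γ → X → X) (S : Set Γ)
    (d : X → X → ℝ) (δ : ℝ) (o : Γ → X) : Prop :=
  ∀ σ ∈ S, ∀ t : Γ, d (T σ (o t)) (o (σ * t)) < δ

/-- The `(S, d)`-shadowing property of the action `T` of `Γ` on `X`. -/
def HasShadowing {Γ X : Type*} [Monoid Γ] (T : Γ → X → X) (S : Set Γ)
    (d : X → X → ℝ) : Prop :=
  ∀ ε > (0 : ℝ), ∃ δ > (0 : ℝ), ∀ o : Γ → X, IsPseudoOrbit T S d δ o →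
    ∃ x : X, ∀ t : Γ, d (T t x) (o t) < ε

/-- The intrinsic shadowing property for an action of a finitely generated monoid `Γ`
on a subshift `X ⊆ A^G` (given via the inclusion `ι : X → (G → A)`): the
`(S, d|_X)`-shadowing property holds for every finite generating set `S` of `Γ`
and every standard Hamming metric `d` on `A^G`. -/
def HasShadowingProperty {Γ G A X : Type*} [Monoid Γ] [Monoid G]
    (ι : X → (G → A)) (T : Γ → X → X) : Prop :=
  ∀ S : Set Γ, S.Finite → Submonoid.closure S = ⊤ →
    ∀ E : ℕ → Finset G, IsExhaustion E →
      HasShadowing T S fun x y => hamming E (ι x) (ι y)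

theorem DegLex.finite_Iic {σ : Type*} [LinearOrder σ] [Finite σ] (u : DegLex (σ →₀ ℕ)) :
    (Set.Iic u).Finite :=
  (Finsupp.finite_of_degree_le (σ := σ) (ofDegLex u).degree).subset
    fun _ hv => Finsupp.DegLex.monotone_degree hv

theorem DegLex.exists_subseq_add {σ : Type*} [LinearOrder σ] [Finite σ]
    (f : ℕ → DegLex (σ →₀ ℕ)) : ∃ g : ℕ ↪o ℕ, ∀ n, ∃ s, f (g (n + 1)) = f (g n) + s := by
  obtain ⟨g, hg⟩ := (wellQuasiOrdered_le (α := σ →₀ ℕ)).exists_monotone_subseq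
    fun n => ofDegLex (f n)
  refine ⟨g, fun n => ?_⟩
  obtain ⟨s, hs⟩ := le_iff_exists_add.1 (hg n (n + 1) n.le_succ)
  exact ⟨toDegLex s, congrArg toDegLex hs⟩

/-- A monoid generated by finitely many commuting elements is a quotient of a free commutative
monoid, here written with the degree-lexicographic order. -/
theorem Submonoid.exists_degLex_surjective {Γ : Type*} [Monoid Γ] {r : ℕ} (g : Fin r → Γ)
    (hcomm : ∀ i j, Commute (g i) (g j)) (hg : Submonoid.closure (Set.range g) = ⊤) :
    ∃ φ : DegLex (Fin r →₀ ℕ) → Γ, (∀ u v, φ (u + v) = φ u * φ v) ∧ Function.Surjective φ := by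
  have hc : Pairwise fun i j => ∀ x y : Multiplicative ℕ,
      Commute (powersHom Γ (g i) x) (powersHom Γ (g j) y) := by
    intro i j _ x y
    simpa [powersHom_apply] using (hcomm i j).pow_pow x.toAdd y.toAdd
  let Φ := MonoidHom.noncommPiCoprod (fun i => powersHom Γ (g i)) hc
  have hΦ : MonoidHom.mrange Φ = ⊤ := by
    rw [eq_top_iff, ← hg, Submonoid.closure_le, MonoidHom.noncommPiCoprod_mrange]
    rintro _ ⟨i, rfl⟩
    exact (le_iSup (fun i => MonoidHom.mrange (powersHom Γ (g i))) i)
      ⟨Multiplicative.ofAdd 1, by simp [powersHom_apply]⟩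
  refine ⟨fun u => Φ fun i => Multiplicative.ofAdd (ofDegLex u i), fun u v => ?_, fun γ => ?_⟩
  · rw [← map_mul]
    rfl
  · obtain ⟨x, rfl⟩ := MonoidHom.mrange_eq_top.1 hΦ γ
    exact ⟨toDegLex (Finsupp.equivFunOnFinite.symm fun i => (x i).toAdd), rfl⟩

section LinearCompactness

variable {R V A ι : Type*} [Ring R] [AddCommGroup V] [Module R V] [AddCommGroup A] [Module R A]

/-- Every finite subfamily has a common point. -/
def HasFiniteInter (𝓕 : Set (AffineSubspace R V)) : Prop :=
  ∀ T ⊆ 𝓕, T.Finite → ∃ x, ∀ K ∈ T, x ∈ K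

theorem HasFiniteInter.exists_maximal {𝓕 : Set (AffineSubspace R V)} (h : HasFiniteInter 𝓕) :
    ∃ 𝓜, 𝓕 ⊆ 𝓜 ∧ Maximal HasFiniteInter 𝓜 := by
  have hF : Order.IsOfFiniteCharacter {𝓖 : Set (AffineSubspace R V) | HasFiniteInter 𝓖} :=
    fun 𝓖 => ⟨fun h T hT _ S hS => h S (hS.trans hT),
      fun h T hT hfin => h T hT hfin T subset_rfl hfin⟩
  exact hF.exists_maximal h

theorem mem_of_maximal_hasFiniteInter {𝓜 : Set (AffineSubspace R V)}
    (h : Maximal HasFiniteInter 𝓜) (L : AffineSubspace R V)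
    (hL : ∀ T ⊆ 𝓜, T.Finite → ∃ x ∈ L, ∀ K ∈ T, x ∈ K) : L ∈ 𝓜 := by
  refine h.2 (y := insert L 𝓜) (fun T hT hfin => ?_) (Set.subset_insert _ _) (Set.mem_insert _ _)
  obtain ⟨x, hxL, hx⟩ := hL (T \ {L}) (by grind) hfin.sdiff
  refine ⟨x, fun K hK => ?_⟩
  by_cases hKL : K = L
  · exact hKL ▸ hxL
  · exact hx K ⟨hK, hKL⟩

/-- The solution set of `f x = w`. -/
def LinearMap.solutions {W : Type*} [AddCommGroup W] [Module R W] (f : V →ₗ[R] W) (w : W) :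
    AffineSubspace R V :=
  (AffineSubspace.mk' w ⊥).comap f.toAffineMap

theorem LinearMap.mem_solutions {W : Type*} [AddCommGroup W] [Module R W] {f : V →ₗ[R] W} {w : W}
    {x : V} : x ∈ f.solutions w ↔ f x = w := by
  simp [LinearMap.solutions, AffineSubspace.mem_comap, AffineSubspace.mem_mk', sub_eq_zero]

theorem exists_solutions_mem_of_maximal [IsArtinian R A] {𝓜 : Set (AffineSubspace R V)}
    (h : Maximal HasFiniteInter 𝓜) (f : V →ₗ[R] A) : ∃ a, f.solutions a ∈ 𝓜 := by
  let img (T : Set (AffineSubspace R V)) : AffineSubspace R A := (sInf T).map f.toAffineMap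
  have himg : ∀ T ⊆ 𝓜, T.Finite → (img T : Set A).Nonempty := by
    intro T hT hfin
    obtain ⟨x, hx⟩ := h.1 T hT hfin
    exact ⟨f x, AffineSubspace.mem_map_of_mem _ ((AffineSubspace.mem_sInf_iff _ _).2 hx)⟩
  obtain ⟨T₀, ⟨hT₀, hfin₀⟩, hmin⟩ := exists_minimalFor_of_wellFoundedLT
    (fun T : Set (AffineSubspace R V) => T ⊆ 𝓜 ∧ T.Finite) (fun T => (img T).direction)
    ⟨∅, Set.empty_subset _, Set.finite_empty⟩
  obtain ⟨a, ha⟩ := himg T₀ hT₀ hfin₀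
  refine ⟨a, mem_of_maximal_hasFiniteInter h _ fun T hT hfin => ?_⟩
  have hU : T₀ ∪ T ⊆ 𝓜 := Set.union_subset hT₀ hT
  have hle : img (T₀ ∪ T) ≤ img T₀ :=
    AffineSubspace.map_mono _ (sInf_le_sInf Set.subset_union_left)
  have heq : img (T₀ ∪ T) = img T₀ := AffineSubspace.eq_of_direction_eq_of_nonempty_of_le
    ((AffineSubspace.direction_le hle).antisymm
      (hmin ⟨hU, hfin₀.union hfin⟩ (AffineSubspace.direction_le hle)))
    (himg _ hU (hfin₀.union hfin)) hle
  have ha' : a ∈ img (T₀ ∪ T) := heq ▸ ha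
  obtain ⟨x, hx, hxa⟩ := ha'
  exact ⟨x, LinearMap.mem_solutions.2 hxa, fun K hK =>
    (AffineSubspace.mem_sInf_iff _ _).1 hx K (Set.mem_union_right _ hK)⟩

/-- Linear compactness: a family of affine subspaces with the finite intersection property has a
common limit point, coordinates being taken in an Artinian module. -/
theorem HasFiniteInter.exists_limit [IsArtinian R A] {𝓕 : Set (AffineSubspace R V)}
    (h : HasFiniteInter 𝓕) (ev : ι → V →ₗ[R] A) :
    ∃ x : ι → A, ∀ K ∈ 𝓕, ∀ s : Set ι, s.Finite → ∃ z ∈ K, ∀ i ∈ s, ev i z = x i := by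
  obtain ⟨𝓜, h𝓕, hmax⟩ := h.exists_maximal
  choose x hx using fun i => exists_solutions_mem_of_maximal hmax (ev i)
  refine ⟨x, fun K hK s hs => ?_⟩
  obtain ⟨z, hz⟩ := hmax.1 (insert K ((fun i => (ev i).solutions (x i)) '' s))
    (Set.insert_subset (h𝓕 hK) (by rintro _ ⟨i, _, rfl⟩; exact hx i)) ((hs.image _).insert K)
  exact ⟨z, hz K (Set.mem_insert _ _), fun i hi => LinearMap.mem_solutions.1
    (hz _ (Set.mem_insert_of_mem _ ⟨i, hi, rfl⟩))⟩

end LinearCompactness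

section ChainCondition

variable {P R B : Type*} [Ring R] [AddCommGroup B] [Module R B]

/-- `X` is closed in the prodiscrete topology. -/
def Submodule.IsProdiscreteClosed (X : Submodule R (P → B)) : Prop :=
  ∀ y : P → B, (∀ s : Finset P, ∃ z ∈ X, ∀ v ∈ s, z v = y v) → y ∈ X

/-- The possible leading values at `u` of the elements of `X` vanishing below `u`. -/
def Submodule.leading [LinearOrder P] (X : Submodule R (P → B)) (u : P) : Submodule R B where
  carrier := {b | ∃ y ∈ X, (∀ v < u, y v = 0) ∧ y u = b}
  add_mem' := by
    rintro _ _ ⟨y, hy, hy0, rfl⟩ ⟨z, hz, hz0, rfl⟩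
    exact ⟨y + z, X.add_mem hy hz, fun v hv => by simp [hy0 v hv, hz0 v hv], rfl⟩
  zero_mem' := ⟨0, X.zero_mem, fun _ _ => rfl, rfl⟩
  smul_mem' := by
    rintro c _ ⟨y, hy, hy0, rfl⟩
    exact ⟨c • y, X.smul_mem c hy, fun v hv => by simp [hy0 v hv], rfl⟩

theorem Submodule.leading_mono [LinearOrder P] {X Y : Submodule R (P → B)} (h : X ≤ Y) (u : P) :
    X.leading u ≤ Y.leading u :=
  fun _ ⟨y, hy, hb⟩ => ⟨y, h hy, hb⟩

theorem Submodule.leading_add_le [AddCommMonoid P] [LinearOrder P] [IsOrderedCancelAddMonoid P]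
    {X : Submodule R (P → B)} (hX : ∀ y ∈ X, ∀ t, (fun v => y (v + t)) ∈ X) (u s : P) :
    X.leading (u + s) ≤ X.leading u := by
  rintro _ ⟨y, hy, hy0, rfl⟩
  exact ⟨_, hX y hy s, fun v hv => hy0 _ (by gcongr), rfl⟩

theorem Submodule.le_of_leading_le [LinearOrder P] (hfin : ∀ u : P, (Set.Iic u).Finite)
    {X Y : Submodule R (P → B)} (hXY : X ≤ Y) (hX : X.IsProdiscreteClosed)
    (h : ∀ u, Y.leading u ≤ X.leading u) : Y ≤ X := by
  intro y hy
  have key : ∀ s : Finset P, IsLowerSet (s : Set P) → ∃ z ∈ X, ∀ v ∈ s, z v = y v := by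
    intro s
    induction s using Finset.induction_on_max with
    | empty => exact fun _ => ⟨0, X.zero_mem, by simp⟩
    | insert a s ha ih =>
      intro hlow
      have hlt : ∀ v, v < a → v ∈ s := fun v hv => by
        have := hlow hv.le (show a ∈ (↑(insert a s) : Set P) by simp)
        simpa [hv.ne] using this
      obtain ⟨z, hz, hzy⟩ := ih fun v w hwv hv => hlt w (hwv.trans_lt (ha v hv))
      obtain ⟨w, hw, hw0, hwa⟩ := h a ⟨y - z, Y.sub_mem hy (hXY hz),
        fun v hv => by simp [hzy v (hlt v hv)], rfl⟩
      refine ⟨z + w, X.add_mem hz hw, fun v hv => ?_⟩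
      rcases Finset.mem_insert.1 hv with rfl | hv
      · simp [hwa]
      · simp [hzy v hv, hw0 v (ha v hv)]
  refine hX y fun s => ?_
  have hs : (⋃ u ∈ s, Set.Iic u).Finite := s.finite_toSet.biUnion fun u _ => hfin u
  obtain ⟨z, hz, hzy⟩ := key hs.toFinset (by
    rw [hs.coe_toFinset]
    exact isLowerSet_iUnion₂ fun u _ => isLowerSet_Iic u)
  exact ⟨z, hz, fun v hv => hzy v (hs.mem_toFinset.2 (Set.mem_biUnion hv (Set.mem_Iic.2 le_rfl)))⟩

/-- Descending chain condition for closed shift-invariant submodules over an Artinian alphabet. -/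
theorem Submodule.wellFounded_closed_invariant [AddCommMonoid P] [LinearOrder P]
    [IsOrderedCancelAddMonoid P] [IsArtinian R B] (hfin : ∀ u : P, (Set.Iic u).Finite)
    (hwqo : ∀ f : ℕ → P, ∃ g : ℕ ↪o ℕ, ∀ n, ∃ s, f (g (n + 1)) = f (g n) + s) :
    WellFounded fun X Y : {X : Submodule R (P → B) //
      X.IsProdiscreteClosed ∧ ∀ y ∈ X, ∀ t, (fun v => y (v + t)) ∈ X} => X < Y := by
  rw [RelEmbedding.wellFounded_iff_isEmpty]
  refine ⟨fun e => ?_⟩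
  have hanti : StrictAnti fun n => (e n).1 := fun m n hmn => e.map_rel_iff.2 hmn
  have hlt : ∀ n, ∃ u, ¬ (e n).1.leading u ≤ (e (n + 1)).1.leading u := by
    intro n
    by_contra! hle
    exact (hanti n.lt_succ_self).not_ge
      (le_of_leading_le hfin (hanti n.lt_succ_self).le (e (n + 1)).2.1 hle)
  choose u hu using hlt
  obtain ⟨g, hg⟩ := hwqo u
  have hdesc : StrictAnti fun n => (e (g n)).1.leading (u (g n)) := by
    refine strictAnti_nat_of_succ_lt fun n => ?_
    obtain ⟨s, hs⟩ := hg n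
    refine lt_of_le_of_lt ?_ (lt_of_le_not_ge
      (leading_mono (hanti (g n).lt_succ_self).le (u (g n))) (hu (g n)))
    show (e (g (n + 1))).1.leading (u (g (n + 1))) ≤ _
    rw [hs]
    exact (leading_add_le (e (g (n + 1))).2.2 _ s).trans
      (leading_mono (hanti.antitone (Nat.succ_le_of_lt (g.strictMono n.lt_succ_self))) _)
  exact (RelEmbedding.wellFounded_iff_isEmpty.1 (wellFounded_lt (α := Submodule R B))).false
    (RelEmbedding.ofMonotone (r := (· > · : ℕ → ℕ → Prop)) _ fun m n hmn => hdesc hmn)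

variable {V : Type*} [AddCommGroup V] [Module R V]

/-- Configurations whose translates all look, on the window `F`, like `v ↦ Φ v x` for some `x`. -/
def windowSubmodule [Add P] (Φ : P → V →ₗ[R] B) (F : Finset P) : Submodule R (P → B) where
  carrier := {y | ∀ t, ∃ x, ∀ v ∈ F, y (v + t) = Φ v x}
  add_mem' := by
    intro y z hy hz t
    obtain ⟨x, hx⟩ := hy t
    obtain ⟨w, hw⟩ := hz t
    exact ⟨x + w, fun v hv => by simp [hx v hv, hw v hv]⟩
  zero_mem' := fun t => ⟨0, fun v _ => by simp⟩
  smul_mem' := by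
    intro c y hy t
    obtain ⟨x, hx⟩ := hy t
    exact ⟨c • x, fun v hv => by simp [hx v hv]⟩

/-- The orbit subshift is of finite type: one window `F` controls all others. -/
theorem exists_window [AddCommMonoid P] [LinearOrder P]
    [IsOrderedCancelAddMonoid P] [IsArtinian R B] (hfin : ∀ u : P, (Set.Iic u).Finite)
    (hwqo : ∀ f : ℕ → P, ∃ g : ℕ ↪o ℕ, ∀ n, ∃ s, f (g (n + 1)) = f (g n) + s)
    (Φ : P → V →ₗ[R] B) :
    ∃ F : Finset P, ∀ y ∈ windowSubmodule Φ F, ∀ F' : Finset P, ∃ x, ∀ v ∈ F', y v = Φ v x := by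
  classical
  let X (F : Finset P) : {X : Submodule R (P → B) //
      X.IsProdiscreteClosed ∧ ∀ y ∈ X, ∀ t, (fun v => y (v + t)) ∈ X} :=
    ⟨windowSubmodule Φ F, fun y hy t => by
      obtain ⟨z, hz, hzy⟩ := hy (F.image (· + t))
      obtain ⟨x, hx⟩ := hz t
      exact ⟨x, fun v hv => by rw [← hzy _ (Finset.mem_image_of_mem _ hv), hx v hv]⟩,
      fun y hy s t => by
        obtain ⟨x, hx⟩ := hy (t + s)
        exact ⟨x, fun v hv => by simpa only [add_assoc] using hx v hv⟩⟩
  obtain ⟨_, ⟨F, rfl⟩, hF⟩ := (Submodule.wellFounded_closed_invariant (R := R) (B := B)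
    hfin hwqo).has_min (Set.range X) ⟨_, ∅, rfl⟩
  refine ⟨F, fun y hy F' => ?_⟩
  have hle : X (F ∪ F') ≤ X F := fun z hz t =>
    (hz t).imp fun x hx v hv => hx v (Finset.mem_union_left _ hv)
  have heq : X (F ∪ F') = X F := hle.eq_of_not_lt (hF _ ⟨_, rfl⟩)
  have hy' : y ∈ (X (F ∪ F')).1 := heq ▸ hy
  obtain ⟨x, hx⟩ := hy' 0
  exact ⟨x, fun v hv => by rw [← hx v (Finset.mem_union_right _ hv), add_zero]⟩

end ChainCondition

theorem hamming_lt_of_eqOn {G A : Type*} {E : ℕ → Finset G} (hE : IsExhaustion E) {x y : G → A}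
    {n : ℕ} (h : ∀ g ∈ E n, x g = y g) {ε : ℝ} (hε : (2 : ℝ)⁻¹ ^ n < ε) : hamming E x y < ε := by
  unfold hamming
  split_ifs with hxy
  · exact lt_trans (by positivity) hε
  · obtain ⟨g, hg⟩ := Function.ne_iff.1 hxy
    obtain ⟨m, hm⟩ := hE.2.2 g
    have hmono : Monotone E := monotone_nat_of_le_succ hE.2.1
    have hbdd : BddAbove {k : ℕ | ∀ g ∈ E k, x g = y g} :=
      ⟨m, fun k hk => le_of_not_ge fun hmk => hg (hk g (hmono hmk hm))⟩
    exact (pow_le_pow_of_le_one (by norm_num) (by norm_num) (le_csSup hbdd h)).trans_lt hε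

theorem eqOn_of_hamming_lt {G A : Type*} {E : ℕ → Finset G} (hE : IsExhaustion E) {x y : G → A}
    {n : ℕ} (h : hamming E x y < (2 : ℝ)⁻¹ ^ n) : ∀ g ∈ E n, x g = y g := by
  have hmono : Monotone E := monotone_nat_of_le_succ hE.2.1
  unfold hamming at h
  split_ifs at h with hxy
  · simp [hxy]
  · have hn : n < sSup {k : ℕ | ∀ g ∈ E k, x g = y g} :=
      (pow_lt_pow_iff_right_of_lt_one₀ (by norm_num) (by norm_num)).1 h
    obtain ⟨k, hk, hnk⟩ := exists_lt_of_lt_csSup ⟨0, by simp [hE.1]⟩ hn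
    exact fun g hg => hk g (hmono hnk.le hg)

theorem IsExhaustion.exists_subset {G : Type*} {E : ℕ → Finset G} (hE : IsExhaustion E)
    (s : Finset G) : ∃ n, s ⊆ E n := by
  have hmono : Monotone E := monotone_nat_of_le_succ hE.2.1
  choose N hN using hE.2.2
  exact ⟨s.sup N, fun g hg => hmono (Finset.le_sup hg) (hN g)⟩

section LocalMaps

variable {G R A : Type*} [Ring R] [AddCommGroup A] [Module R A] {X : Submodule R (G → A)}

/-- Values of `f x` on a finite set only depend on the values of `x` on a finite set. -/
def FinitelyDetermined (f : X → X) : Prop :=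
  ∀ s : Finset G, ∃ s' : Finset G, ∀ x y : X, (∀ g ∈ s', x.1 g = y.1 g) →
    ∀ g ∈ s, (f x).1 g = (f y).1 g

theorem isLinearMap_and_finitelyDetermined_of_mem_closure {T : Set (Function.End X)}
    (hT : ∀ f ∈ T, IsLinearMap R f ∧ FinitelyDetermined f) {f : Function.End X}
    (hf : f ∈ Submonoid.closure T) : IsLinearMap R f ∧ FinitelyDetermined f := by
  induction hf using Submonoid.closure_induction with
  | mem f hf => exact hT f hf
  | one => exact ⟨⟨fun _ _ => rfl, fun _ _ => rfl⟩, fun s => ⟨s, fun _ _ h => h⟩⟩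
  | mul f g _ _ hf hg =>
    refine ⟨(hf.1.mk' f ∘ₗ hg.1.mk' g).isLinear, fun s => ?_⟩
    obtain ⟨s₁, h₁⟩ := hf.2 s
    obtain ⟨s₂, h₂⟩ := hg.2 s₁
    exact ⟨s₂, fun x y h => h₁ _ _ (h₂ x y h)⟩

theorem isLinearMap_and_finitelyDetermined_of_local [Mul G] {f : X → X} (M : Finset G)
    (μ : (↥(M : Set G) → A) →ₗ[R] A)
    (hf : ∀ (x : X) (g : G), (f x).1 g = μ fun m : ↥(M : Set G) => x.1 (↑m * g)) :
    IsLinearMap R f ∧ FinitelyDetermined f := by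
  classical
  refine ⟨⟨fun x y => ?_, fun c x => ?_⟩, fun s => ⟨Finset.image₂ (· * ·) M s, ?_⟩⟩
  · ext g
    simp only [Submodule.coe_add, Pi.add_apply, hf]
    exact map_add μ _ _
  · ext g
    simp only [Submodule.coe_smul, Pi.smul_apply, hf]
    exact map_smul μ c _
  · intro x y h g hg
    rw [hf, hf]
    congr 1
    ext m
    exact h _ (Finset.mem_image₂_of_mem m.2 hg)

/-- Errors along generators control the error along any fixed element of the acting monoid. -/
theorem exists_window_of_closure_eq_top {Γ : Submonoid (Function.End X)}
    (hΓ : ∀ γ : Γ, FinitelyDetermined γ.1) {S : Set Γ} (hS : Submonoid.closure S = ⊤)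
    (γ : Γ) : ∀ s : Finset G, ∃ s' : Finset G, ∀ o : Γ → X,
      (∀ σ ∈ S, ∀ t, ∀ g ∈ s', (σ.1 (o t)).1 g = (o (σ * t)).1 g) →
      ∀ t, ∀ g ∈ s, (γ.1 (o t)).1 g = (o (γ * t)).1 g := by
  classical
  induction (hS ▸ Submonoid.mem_top γ : γ ∈ Submonoid.closure S)
    using Submonoid.closure_induction with
  | mem γ hγ => exact fun s => ⟨s, fun o h => h γ hγ⟩
  | one =>
    intro s
    refine ⟨∅, fun o _ t g _ => ?_⟩
    rw [one_mul]
    rfl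
  | mul α β _ _ hα hβ =>
    intro s
    obtain ⟨s₁, h₁⟩ := hα s
    obtain ⟨s₂, h₂⟩ := hΓ α s
    obtain ⟨s₃, h₃⟩ := hβ s₂
    refine ⟨s₁ ∪ s₃, fun o h t g hg => ?_⟩
    rw [mul_assoc, ← h₁ o (fun σ hσ t g hg => h σ hσ t g (Finset.mem_union_left _ hg)) _ g hg]
    exact h₂ _ _ (h₃ o (fun σ hσ t g hg => h σ hσ t g (Finset.mem_union_right _ hg)) t) g hg

theorem mem_of_forall_finset_agree [TopologicalSpace A] (hX : IsClosed (X : Set (G → A)))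
    {x : G → A} (h : ∀ s : Finset G, ∃ z ∈ X, ∀ g ∈ s, z g = x g) : x ∈ X := by
  refine hX.closure_subset (mem_closure_iff.2 fun U hU hxU => ?_)
  obtain ⟨s, u, hu, hsub⟩ := isOpen_pi_iff.1 hU x hxU
  obtain ⟨z, hz, hzx⟩ := h s
  exact ⟨z, hsub fun g hg => by rw [hzx g hg]; exact (hu g hg).2, hz⟩

/-- If an orbit pattern on a finite window is realised along every finite set of times, it is
realised along all times simultaneously. -/
theorem exists_orbit_of_finite_times [IsArtinian R A] [TopologicalSpace A]
    (hX : IsClosed (X : Set (G → A))) {P : Type*} [Nonempty P] {s : Finset G}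
    {f : P → X →ₗ[R] X} (hf : ∀ v, FinitelyDetermined (f v)) (y : P → G → A)
    (h : ∀ F : Finset P, ∃ x, ∀ v ∈ F, ∀ g ∈ s, (f v x).1 g = y v g) :
    ∃ x, ∀ v, ∀ g ∈ s, (f v x).1 g = y v g := by
  classical
  let Φ (v : P) : X →ₗ[R] (s → A) :=
    LinearMap.funLeft R A (Subtype.val : s → G) ∘ₗ X.subtype ∘ₗ f v
  let K (v : P) := (Φ v).solutions fun g => y v g
  have hK : ∀ v x, x ∈ K v ↔ ∀ g ∈ s, (f v x).1 g = y v g := fun v x =>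
    LinearMap.mem_solutions.trans (funext_iff.trans Subtype.forall)
  have hfip : HasFiniteInter (Set.range K) := by
    intro T hT hfin
    choose! w hw using hT
    obtain ⟨x, hx⟩ := h (hfin.toFinset.image w)
    exact ⟨x, fun L hL => hw hL ▸ (hK _ x).2
      (hx _ (Finset.mem_image_of_mem w (hfin.mem_toFinset.2 hL)))⟩
  obtain ⟨x, hx⟩ := hfip.exists_limit fun g : G => LinearMap.proj g ∘ₗ X.subtype
  have hxX : x ∈ X := mem_of_forall_finset_agree hX fun u => by
    obtain ⟨z, -, hz⟩ := hx _ ⟨Classical.arbitrary P, rfl⟩ u u.finite_toSet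
    exact ⟨z, z.2, hz⟩
  refine ⟨⟨x, hxX⟩, fun v g hg => ?_⟩
  obtain ⟨u, hu⟩ := hf v s
  obtain ⟨z, hzK, hz⟩ := hx _ ⟨v, rfl⟩ u u.finite_toSet
  rw [← (hK v z).1 hzK g hg]
  exact hu _ _ (fun i hi => (hz i hi).symm) g hg

end LocalMaps

theorem statement16 {G : Type*} [Monoid G] [Countable G]
    {R : Type*} [Ring R] {A : Type*} [AddCommGroup A] [Module R A] [IsArtinian R A]
    [TopologicalSpace A] [DiscreteTopology A]
    (Sgm : Submodule R (G → A))
    (hshift : ∀ g : G, ∀ x ∈ Sgm, shiftMul g x ∈ Sgm)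
    (hclosed : IsClosed (Sgm : Set (G → A)))
    {r : ℕ} (τ : Fin r → ↥Sgm → ↥Sgm)
    (hcomm : ∀ i j x, τ i (τ j x) = τ j (τ i x))
    (hloc : ∀ i, ∃ (M : Finset G) (μ : (↥(M : Set G) → A) →ₗ[R] A),
      ∀ (x : ↥Sgm) (g : G), (τ i x).1 g = μ fun m : ↥(M : Set G) => x.1 (↑m * g)) :
    HasShadowingProperty (fun x : ↥Sgm => x.1)
      (fun f : ↥(Submonoid.closure (M := Function.End ↥Sgm) (Set.range fun i => τ i)) =>
        fun x : ↥Sgm => f.1 x) := by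
  intro S _ hS E hE ε hε
  obtain ⟨n, hn⟩ := exists_pow_lt_of_lt_one hε (show (2 : ℝ)⁻¹ < 1 by norm_num)
  have hΓ : ∀ γ : ↥(Submonoid.closure (M := Function.End ↥Sgm) (Set.range fun i => τ i)),
      IsLinearMap R γ.1 ∧ FinitelyDetermined γ.1 := fun γ =>
    isLinearMap_and_finitelyDetermined_of_mem_closure (by
      rintro _ ⟨i, rfl⟩
      obtain ⟨M, μ, hμ⟩ := hloc i
      exact isLinearMap_and_finitelyDetermined_of_local M μ hμ) γ.2
  obtain ⟨φ, hφ, hφsurj⟩ := Submonoid.exists_degLex_surjective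
    (fun i => (⟨τ i, Submonoid.subset_closure ⟨i, rfl⟩⟩ :
      ↥(Submonoid.closure (M := Function.End ↥Sgm) (Set.range fun i => τ i))))
    (fun i j => Subtype.ext (funext fun x => hcomm i j x)) (by
      rw [← Submonoid.closure_closure_coe_preimage]
      congr 1
      ext γ
      exact exists_congr fun i => Subtype.ext_iff)
  let f (v : DegLex (Fin r →₀ ℕ)) : Sgm →ₗ[R] Sgm := (hΓ (φ v)).1.mk' _
  let Φ (v : DegLex (Fin r →₀ ℕ)) : Sgm →ₗ[R] (E n → A) :=
    LinearMap.funLeft R A (Subtype.val : E n → G) ∘ₗ Sgm.subtype ∘ₗ f v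
  obtain ⟨F, hF⟩ := exists_window DegLex.finite_Iic DegLex.exists_subseq_add Φ
  choose D hD using fun v =>
    exists_window_of_closure_eq_top (fun γ => (hΓ γ).2) hS (φ v) (E n)
  classical
  obtain ⟨m, hm⟩ := hE.exists_subset (F.biUnion D)
  refine ⟨(2 : ℝ)⁻¹ ^ m, by positivity, fun o ho => ?_⟩
  have hoE : ∀ v ∈ F, ∀ t, ∀ g ∈ E n, ((φ v).1 (o t)).1 g = (o (φ v * t)).1 g := fun v hv =>
    hD v o fun σ hσ t g hg =>
      eqOn_of_hamming_lt hE (ho σ hσ t) g (hm (Finset.mem_biUnion.2 ⟨v, hv, hg⟩))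
  have hy : (fun v (g : E n) => (o (φ v)).1 g) ∈ windowSubmodule Φ F := fun t =>
    ⟨o (φ t), fun v hv => funext fun g => by
      change (o (φ (v + t))).1 g = _
      rw [hφ]
      exact (hoE v hv (φ t) g g.2).symm⟩
  obtain ⟨x, hx⟩ := exists_orbit_of_finite_times hclosed (s := E n) (f := f)
    (fun v => (hΓ (φ v)).2) (fun v => (o (φ v)).1) fun F' => by
      obtain ⟨x, hx⟩ := hF _ hy F'
      exact ⟨x, fun v hv g hg => (congrFun (hx v hv) ⟨g, hg⟩).symm⟩
  refine ⟨x, fun t => ?_⟩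
  obtain ⟨v, rfl⟩ := hφsurj t
  exact hamming_lt_of_eqOn hE (hx v) hn
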